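/- arXiv:1605.05865 — 3 statements merged into one kernel-verified Lean document; each statement's English description precedes it below -/
import Mathlib

section
/- Let u, ρ, p : ℝ × ℝ → ℝ be sufficiently smooth (say C^∞) functions of (x,t), and for z ∈ ℂ \ {0} define the 2×2 matrix-valued functions V = [[0,0],[1/(4z) − u, 0]] − z[[−u_x, −1],[u_x² + ρ², u_x]] and W = (1/(4z))[[0,0],[u − 1/(2z), 0]] + [[0, −1/2],[p, 0]] + z u [[−u_x, −1],[u_x² + ρ², u_x]]. Then the zero-curvature (compatibility) condition V_t − W_x + [V, W] = 0 holds identically for all z ∈ ℂ \ {0} if and only if (u, ρ, p) solves the two-component Camassa–Holm system u_t + u u_x + p_x = 0, ρ_t + (uρ)_x = 0, p − p_xx = u² + ½ u_x² + ½ ρ². -/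
open MeasureTheory Filter Set Topology

noncomputable section
/-- Partial derivative with respect to the first variable. -/
def pd1 (f : ℝ → ℝ → ℝ) (a b : ℝ) : ℝ := deriv (fun a' => f a' b) a

/-- Partial derivative with respect to the second variable. -/
def pd2 (f : ℝ → ℝ → ℝ) (a b : ℝ) : ℝ := deriv (fun b' => f a b') b
/-- The matrix `[[−u_x, −1],[u_x² + ρ², u_x]]`. -/
def chA (u ρ : ℝ → ℝ → ℝ) (x t : ℝ) : Matrix (Fin 2) (Fin 2) ℂ :=
  !![-(pd1 u x t : ℂ), -1; (pd1 u x t : ℂ)^2 + (ρ x t : ℂ)^2, (pd1 u x t : ℂ)]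

/-- `V = [[0,0],[1/(4z) − u, 0]] − z [[−u_x, −1],[u_x² + ρ², u_x]]`. -/
def chV (u ρ : ℝ → ℝ → ℝ) (z : ℂ) (x t : ℝ) : Matrix (Fin 2) (Fin 2) ℂ :=
  !![0, 0; 1/(4*z) - (u x t : ℂ), 0] - z • chA u ρ x t

/-- `W = (1/(4z))[[0,0],[u − 1/(2z),0]] + [[0,−1/2],[p,0]]
  + z u [[−u_x,−1],[u_x²+ρ²,u_x]]`. -/
def chW (u ρ p : ℝ → ℝ → ℝ) (z : ℂ) (x t : ℝ) : Matrix (Fin 2) (Fin 2) ℂ :=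
  (1/(4*z)) • !![0, 0; (u x t : ℂ) - 1/(2*z), 0]
    + !![0, -(1/2 : ℂ); (p x t : ℂ), 0]
    + (z * (u x t : ℂ)) • chA u ρ x t
/-- The partial derivative in the first variable is the derivative in the direction `(1, 0)`. -/
lemma hasDerivAt_fst {f : ℝ → ℝ → ℝ} (hf : ContDiff ℝ (⊤ : ℕ∞) (Function.uncurry f)) (x t : ℝ) :
    HasDerivAt (fun y => f y t) (fderiv ℝ (Function.uncurry f) (x, t) (1, 0)) x :=
  ((hf.differentiable (by simp)).differentiableAt (x := (x, t))).hasFDerivAt.comp_hasDerivAt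
    (f := fun y => (y, t)) x ((hasDerivAt_id x).prodMk (hasDerivAt_const x t))

/-- The partial derivative in the second variable is the derivative in the direction `(0, 1)`. -/
lemma hasDerivAt_snd {f : ℝ → ℝ → ℝ} (hf : ContDiff ℝ (⊤ : ℕ∞) (Function.uncurry f)) (x t : ℝ) :
    HasDerivAt (fun s => f x s) (fderiv ℝ (Function.uncurry f) (x, t) (0, 1)) t :=
  ((hf.differentiable (by simp)).differentiableAt (x := (x, t))).hasFDerivAt.comp_hasDerivAt
    (f := fun s => (x, s)) t ((hasDerivAt_const t x).prodMk (hasDerivAt_id t))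

lemma uncurry_pd1 {f : ℝ → ℝ → ℝ} (hf : ContDiff ℝ (⊤ : ℕ∞) (Function.uncurry f)) :
    Function.uncurry (pd1 f) = fun q => fderiv ℝ (Function.uncurry f) q (1, 0) :=
  funext fun q => (hasDerivAt_fst hf q.1 q.2).deriv

lemma uncurry_pd2 {f : ℝ → ℝ → ℝ} (hf : ContDiff ℝ (⊤ : ℕ∞) (Function.uncurry f)) :
    Function.uncurry (pd2 f) = fun q => fderiv ℝ (Function.uncurry f) q (0, 1) :=
  funext fun q => (hasDerivAt_snd hf q.1 q.2).deriv

lemma hasDerivAt_pd1 {f : ℝ → ℝ → ℝ} (hf : ContDiff ℝ (⊤ : ℕ∞) (Function.uncurry f)) (x t : ℝ) :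
    HasDerivAt (fun y => f y t) (pd1 f x t) x :=
  (hasDerivAt_fst hf x t).differentiableAt.hasDerivAt

lemma hasDerivAt_pd2 {f : ℝ → ℝ → ℝ} (hf : ContDiff ℝ (⊤ : ℕ∞) (Function.uncurry f)) (x t : ℝ) :
    HasDerivAt (fun s => f x s) (pd2 f x t) t :=
  (hasDerivAt_snd hf x t).differentiableAt.hasDerivAt

lemma contDiff_pd1 {f : ℝ → ℝ → ℝ} (hf : ContDiff ℝ (⊤ : ℕ∞) (Function.uncurry f)) :
    ContDiff ℝ (⊤ : ℕ∞) (Function.uncurry (pd1 f)) := by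
  rw [uncurry_pd1 hf]
  exact (hf.fderiv_right (m := (⊤ : ℕ∞)) (by simp)).clm_apply contDiff_const

lemma contDiff_pd2 {f : ℝ → ℝ → ℝ} (hf : ContDiff ℝ (⊤ : ℕ∞) (Function.uncurry f)) :
    ContDiff ℝ (⊤ : ℕ∞) (Function.uncurry (pd2 f)) := by
  rw [uncurry_pd2 hf]
  exact (hf.fderiv_right (m := (⊤ : ℕ∞)) (by simp)).clm_apply contDiff_const

/-- Mixed partial derivatives of a smooth function commute. -/
lemma pd1_pd2_comm {f : ℝ → ℝ → ℝ} (hf : ContDiff ℝ (⊤ : ℕ∞) (Function.uncurry f)) (x t : ℝ) :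
    pd1 (pd2 f) x t = pd2 (pd1 f) x t := by
  have hd : DifferentiableAt ℝ (fderiv ℝ (Function.uncurry f)) (x, t) :=
    ((hf.fderiv_right (m := (⊤ : ℕ∞)) (by simp)).differentiable (by simp)).differentiableAt
  have hsymm : IsSymmSndFDerivAt ℝ (Function.uncurry f) (x, t) :=
    hf.contDiffAt.isSymmSndFDerivAt (by
      simpa using WithTop.coe_le_coe.2 (le_top (a := (2 : ℕ∞))))
  have key (v w : ℝ × ℝ) : fderiv ℝ (fun q => fderiv ℝ (Function.uncurry f) q v) (x, t) w
      = fderiv ℝ (fderiv ℝ (Function.uncurry f)) (x, t) w v := by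
    rw [fderiv_clm_apply hd (differentiableAt_const v)]
    simp
  have h12 : pd1 (pd2 f) x t = _ := (hasDerivAt_fst (contDiff_pd2 hf) x t).deriv
  have h21 : pd2 (pd1 f) x t = _ := (hasDerivAt_snd (contDiff_pd1 hf) x t).deriv
  rw [h12, h21, uncurry_pd1 hf, uncurry_pd2 hf, key, key]
  exact hsymm _ _

/-- The residual of the diagonal entries of the zero-curvature condition. -/
def chDiag (u ρ p : ℝ → ℝ → ℝ) (x t : ℝ) : ℝ :=
  pd2 (pd1 u) x t + u x t * pd1 (pd1 u) x t + (1/2) * pd1 u x t ^ 2 + p x t - u x t ^ 2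
    - (1/2) * ρ x t ^ 2

/-- The residual of the momentum equation. -/
def chMom (u p : ℝ → ℝ → ℝ) (x t : ℝ) : ℝ :=
  pd2 u x t + u x t * pd1 u x t + pd1 p x t

/-- The residual of the continuity equation. -/
def chCont (u ρ : ℝ → ℝ → ℝ) (x t : ℝ) : ℝ :=
  pd2 ρ x t + (pd1 u x t * ρ x t + u x t * pd1 ρ x t)

/-- The zero-curvature matrix `V_t − W_x + [V, W]`, expressed through the residuals. -/
lemma zero_curvature_eq {u ρ p : ℝ → ℝ → ℝ}
    (hu : ContDiff ℝ (⊤ : ℕ∞) (Function.uncurry u)) (hρ : ContDiff ℝ (⊤ : ℕ∞) (Function.uncurry ρ))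
    (hp : ContDiff ℝ (⊤ : ℕ∞) (Function.uncurry p)) {z : ℂ} (hz : z ≠ 0) (x t : ℝ) (i j : Fin 2) :
    deriv (fun τ => chV u ρ z x τ i j) t - deriv (fun χ => chW u ρ p z χ t i j) x
        + (chV u ρ z x t * chW u ρ p z x t - chW u ρ p z x t * chV u ρ z x t) i j
      = !![z * (chDiag u ρ p x t : ℂ), 0;
          -(chMom u p x t : ℂ) - 2 * z * ((pd1 u x t : ℂ) * (chDiag u ρ p x t : ℂ)
            + (ρ x t : ℂ) * (chCont u ρ x t : ℂ)), -(z * (chDiag u ρ p x t : ℂ))] i j := by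
  have ut := (hasDerivAt_pd2 hu x t).ofReal_comp
  have ux := (hasDerivAt_pd1 hu x t).ofReal_comp
  have px := (hasDerivAt_pd1 hp x t).ofReal_comp
  have rt := (hasDerivAt_pd2 hρ x t).ofReal_comp
  have rx := (hasDerivAt_pd1 hρ x t).ofReal_comp
  have at' := (hasDerivAt_pd2 (contDiff_pd1 hu) x t).ofReal_comp
  have ax := (hasDerivAt_pd1 (contDiff_pd1 hu) x t).ofReal_comp
  have bt := (at'.fun_pow 2).fun_add (rt.fun_pow 2)
  have bx := (ax.fun_pow 2).fun_add (rx.fun_pow 2)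
  fin_cases i <;> fin_cases j <;>
    simp only [chV, chW, chA, chDiag, chMom, chCont, Matrix.sub_apply, Matrix.add_apply,
      Matrix.smul_apply, Matrix.mul_apply, Fin.sum_univ_two, Matrix.of_apply, Matrix.cons_val',
      Matrix.cons_val_zero, Matrix.cons_val_one, Matrix.cons_val_fin_one, Fin.zero_eta,
      Fin.mk_one, smul_eq_mul]
  · rw [((at'.fun_neg.const_mul z).const_sub 0).deriv,
      (((ux.const_mul z).fun_mul ax.fun_neg).const_add _).deriv]
    push_cast
    field_simp
    ring
  · rw [deriv_const, (((ux.const_mul z).mul_const (-1)).const_add _).deriv]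
    field_simp
    ring
  · rw [((ut.const_sub _).fun_sub (bt.const_mul z)).deriv,
      ((((ux.sub_const _).const_mul _).fun_add px).fun_add
        ((ux.const_mul z).fun_mul bx)).deriv]
    push_cast
    field_simp
    ring
  · rw [((at'.const_mul z).const_sub 0).deriv,
      (((ux.const_mul z).fun_mul ax).const_add _).deriv]
    push_cast
    field_simp
    ring

/-- If `ρ` times the residual of the continuity equation vanishes, so does the residual: near a
point where it did not, `ρ` would vanish identically. -/
lemma chCont_eq_zero_of_mul {u ρ : ℝ → ℝ → ℝ}
    (hu : ContDiff ℝ (⊤ : ℕ∞) (Function.uncurry u)) (hρ : ContDiff ℝ (⊤ : ℕ∞) (Function.uncurry ρ))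
    (h : ∀ x t, ρ x t * chCont u ρ x t = 0) (x t : ℝ) : chCont u ρ x t = 0 := by
  by_contra hne
  have hcont : Continuous (fun q : ℝ × ℝ => chCont u ρ q.1 q.2) :=
    (contDiff_pd2 hρ).continuous.add (((contDiff_pd1 hu).continuous.mul hρ.continuous).add
      (hu.continuous.mul (contDiff_pd1 hρ).continuous))
  have hev : ∀ᶠ q in 𝓝 (x, t), ρ q.1 q.2 = 0 :=
    (hcont.continuousAt.eventually_ne (x := (x, t)) hne).mono
      fun q hq => (mul_eq_zero.1 (h q.1 q.2)).resolve_right hq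
  have hx : (fun y => ρ y t) =ᶠ[𝓝 x] fun _ => 0 :=
    (Continuous.prodMk_left t).continuousAt.eventually hev
  have ht : (fun s => ρ x s) =ᶠ[𝓝 t] fun _ => 0 :=
    (Continuous.prodMk_right x).continuousAt.eventually hev
  have h1 : pd1 ρ x t = 0 := by rw [pd1, hx.deriv_eq, deriv_const]
  have h2 : pd2 ρ x t = 0 := by rw [pd2, ht.deriv_eq, deriv_const]
  have h0 : ρ x t = 0 := hev.self_of_nhds
  exact hne (by simp [chCont, h0, h1, h2])

/-- If the momentum equation holds, so does its derivative in space. -/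
lemma pd1_chMom {u p : ℝ → ℝ → ℝ}
    (hu : ContDiff ℝ (⊤ : ℕ∞) (Function.uncurry u)) (hp : ContDiff ℝ (⊤ : ℕ∞) (Function.uncurry p))
    (h : ∀ x t, chMom u p x t = 0) (x t : ℝ) :
    pd2 (pd1 u) x t + (pd1 u x t ^ 2 + u x t * pd1 (pd1 u) x t) + pd1 (pd1 p) x t = 0 := by
  have hd := ((hasDerivAt_pd1 (contDiff_pd2 hu) x t).fun_add ((hasDerivAt_pd1 hu x t).fun_mul
    (hasDerivAt_pd1 (contDiff_pd1 hu) x t))).fun_add (hasDerivAt_pd1 (contDiff_pd1 hp) x t)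
  have h0 : (fun y => pd2 u y t + u y t * pd1 u y t + pd1 p y t) = fun _ => 0 :=
    funext fun y => h y t
  rw [h0, pd1_pd2_comm hu] at hd
  linear_combination hd.unique (hasDerivAt_const x 0)

/-- the zero-curvature condition `V_t − W_x + [V,W] = 0` for all
`z ≠ 0` is equivalent to the two-component Camassa–Holm system. -/
theorem stmt_14 (u ρ p : ℝ → ℝ → ℝ)
    (hu : ContDiff ℝ (⊤ : ℕ∞) (Function.uncurry u)) (hρ : ContDiff ℝ (⊤ : ℕ∞) (Function.uncurry ρ))
    (hp : ContDiff ℝ (⊤ : ℕ∞) (Function.uncurry p)) :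
    (∀ z : ℂ, z ≠ 0 → ∀ x t : ℝ, ∀ i j : Fin 2,
      deriv (fun τ => chV u ρ z x τ i j) t - deriv (fun χ => chW u ρ p z χ t i j) x
        + (chV u ρ z x t * chW u ρ p z x t - chW u ρ p z x t * chV u ρ z x t) i j = 0)
    ↔ ∀ x t : ℝ,
        pd2 u x t + u x t * pd1 u x t + pd1 p x t = 0 ∧
        pd2 ρ x t + (pd1 u x t * ρ x t + u x t * pd1 ρ x t) = 0 ∧
        p x t - pd1 (pd1 p) x t
          = u x t ^ 2 + (1/2) * (pd1 u x t)^2 + (1/2) * (ρ x t)^2 := by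
  constructor
  · intro h
    have entry (z : ℂ) (hz : z ≠ 0) (x t : ℝ) (i j : Fin 2) :=
      (zero_curvature_eq hu hρ hp hz x t i j).symm.trans (h z hz x t i j)
    have hD (x t : ℝ) : chDiag u ρ p x t = 0 := by
      simpa using entry 1 one_ne_zero x t 0 0
    have hlow (x t : ℝ) : chMom u p x t = 0 ∧ ρ x t * chCont u ρ x t = 0 := by
      have e1 := entry 1 one_ne_zero x t 1 0
      have e2 := entry (-1) (neg_ne_zero.2 one_ne_zero) x t 1 0
      simp only [hD, Complex.ofReal_zero, Matrix.of_apply, Matrix.cons_val', Matrix.cons_val_zero, Matrix.cons_val_one,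
        Matrix.cons_val_fin_one] at e1 e2
      constructor <;> rw [← Complex.ofReal_eq_zero]
      · linear_combination -(e1 + e2) / 2
      · push_cast
        linear_combination (e2 - e1) / 4
    intro x t
    refine ⟨(hlow x t).1, chCont_eq_zero_of_mul hu hρ (fun y s => (hlow y s).2) x t, ?_⟩
    have hx := pd1_chMom hu hp (fun y s => (hlow y s).1) x t
    have hd := hD x t
    rw [chDiag] at hd
    linarith
  · intro h z hz x t i j
    have hM (x t : ℝ) : chMom u p x t = 0 := (h x t).1
    have hC : chCont u ρ x t = 0 := (h x t).2.1
    have hD : chDiag u ρ p x t = 0 := by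
      rw [chDiag]
      linarith [(h x t).2.2, pd1_chMom hu hp hM x t]
    rw [zero_curvature_eq hu hρ hp hz, hM, hC, hD]
    fin_cases i <;> fin_cases j <;> simp
end
end

section
/- Let y, U, H : ℝ → ℝ be sufficiently smooth functions such that y is nondecreasing, y − id, U and the derivatives y_ξ − 1, U_ξ, H_ξ decay spatially fast enough that the following integrals converge (e.g., 2U²y_ξ + H_ξ is integrable on ℝ), and define P(ξ) = ¼ ∫_ℝ e^{−|y(ξ) − y(s)|} (2U(s)² y_ξ(s) + H_ξ(s)) ds and Q(ξ) = −¼ ∫_ℝ sign(ξ − s) e^{−|y(ξ) − y(s)|} (2U(s)² y_ξ(s) + H_ξ(s)) ds. Then P_ξ(ξ) = y_ξ(ξ) Q(ξ) for all ξ ∈ ℝ, and P satisfies the differential equation y_ξ P_{ξξ} − y_{ξξ} P_ξ − y_ξ³ P = −½ y_ξ² (2U² y_ξ + H_ξ); moreover P is constant on every interval on which y is constant. -/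
open MeasureTheory Filter Set Topology

noncomputable section
/-- The weight `2U² y_ξ + H_ξ`. -/
def lagW (y U H : ℝ → ℝ) (s : ℝ) : ℝ := 2 * (U s)^2 * deriv y s + deriv H s

/-- `P(ξ) = ¼ ∫_ℝ e^{−|y(ξ)−y(s)|} (2U² y_ξ + H_ξ)(s) ds`. -/
def lagP (y U H : ℝ → ℝ) (ξ : ℝ) : ℝ :=
  (1/4) * ∫ s : ℝ, Real.exp (-|y ξ - y s|) * lagW y U H s

/-- `Q(ξ) = −¼ ∫_ℝ sign(ξ−s) e^{−|y(ξ)−y(s)|} (2U² y_ξ + H_ξ)(s) ds`. -/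
def lagQ (y U H : ℝ → ℝ) (ξ : ℝ) : ℝ :=
  -(1/4) * ∫ s : ℝ, Real.sign (ξ - s) * Real.exp (-|y ξ - y s|) * lagW y U H s

/-- The mass of `e^y w` to the left of `ξ`. -/
def leftMass (y w : ℝ → ℝ) (ξ : ℝ) : ℝ := ∫ s in Iic ξ, Real.exp (y s) * w s

/-- The mass of `e^{-y} w` to the right of `ξ`. -/
def rightMass (y w : ℝ → ℝ) (ξ : ℝ) : ℝ := ∫ s in Ioi ξ, Real.exp (-y s) * w s

theorem hasDerivAt_integral_Iic {f : ℝ → ℝ} (hf : Continuous f)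
    (hi : ∀ x, IntegrableOn f (Iic x)) (x : ℝ) :
    HasDerivAt (fun u => ∫ s in Iic u, f s) (f x) x := by
  have h : (fun u => ∫ s in Iic u, f s) = fun u => (∫ s in Iic 0, f s) + ∫ s in (0 : ℝ)..u, f s := by
    funext u
    rw [← intervalIntegral.integral_Iic_sub_Iic (hi 0) (hi u)]
    ring
  rw [h]
  exact (hf.integral_hasStrictDerivAt 0 x).hasDerivAt.const_add _

theorem hasDerivAt_integral_Ioi {f : ℝ → ℝ} (hf : Continuous f)
    (hi : ∀ x, IntegrableOn f (Ioi x)) (x : ℝ) :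
    HasDerivAt (fun u => ∫ s in Ioi u, f s) (-f x) x := by
  have h : (fun u => ∫ s in Ioi u, f s) = fun u => (∫ s in Ioi 0, f s) - ∫ s in (0 : ℝ)..u, f s := by
    funext u
    rw [← intervalIntegral.integral_Ioi_sub_Ioi' (hi 0) (hi u)]
    ring
  rw [h]
  exact (hf.integral_hasStrictDerivAt 0 x).hasDerivAt.const_sub _

section Green

variable {y w : ℝ → ℝ}

theorem integrableOn_exp_comp_mul_Iic (hy : Continuous y) (hmono : Monotone y) (hint : Integrable w)
    (ξ : ℝ) : IntegrableOn (fun s => Real.exp (y s) * w s) (Iic ξ) := by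
  refine hint.integrableOn.bdd_mul (c := Real.exp (y ξ))
    (Real.continuous_exp.comp hy).aestronglyMeasurable ?_
  filter_upwards [ae_restrict_mem measurableSet_Iic] with s hs
  rw [Real.norm_eq_abs, Real.abs_exp]
  exact Real.exp_le_exp.2 (hmono hs)

theorem integrableOn_exp_neg_comp_mul_Ioi (hy : Continuous y) (hmono : Monotone y)
    (hint : Integrable w) (ξ : ℝ) :
    IntegrableOn (fun s => Real.exp (-y s) * w s) (Ioi ξ) := by
  refine hint.integrableOn.bdd_mul (c := Real.exp (-y ξ))
    (Real.continuous_exp.comp hy.neg).aestronglyMeasurable ?_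
  filter_upwards [ae_restrict_mem measurableSet_Ioi] with s hs
  rw [Real.norm_eq_abs, Real.abs_exp]
  exact Real.exp_le_exp.2 (neg_le_neg (hmono (le_of_lt hs)))

/-- An integral against `e^{-|y(ξ)-y(s)|}` with a factor taking one value on each side of `ξ`. -/
theorem integral_exp_neg_abs_eq (hy : Continuous y) (hmono : Monotone y) (hint : Integrable w)
    (ξ : ℝ) {σ : ℝ → ℝ} {a b : ℝ} (ha : ∀ s < ξ, σ s = a) (hb : ∀ s > ξ, σ s = b) :
    ∫ s, σ s * Real.exp (-|y ξ - y s|) * w s =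
      a * Real.exp (-y ξ) * leftMass y w ξ + b * Real.exp (y ξ) * rightMass y w ξ := by
  have hl : (fun s => a * Real.exp (-y ξ) * (Real.exp (y s) * w s)) =ᵐ[volume.restrict (Iic ξ)]
      fun s => σ s * Real.exp (-|y ξ - y s|) * w s := by
    rw [Measure.restrict_congr_set Iio_ae_eq_Iic.symm]
    filter_upwards [ae_restrict_mem measurableSet_Iio] with s hs
    have hs' : s < ξ := hs
    rw [ha s hs', abs_of_nonneg (sub_nonneg.2 (hmono hs'.le)), neg_sub, sub_eq_add_neg,
      Real.exp_add]
    ring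
  have hr : (fun s => b * Real.exp (y ξ) * (Real.exp (-y s) * w s)) =ᵐ[volume.restrict (Ioi ξ)]
      fun s => σ s * Real.exp (-|y ξ - y s|) * w s := by
    filter_upwards [ae_restrict_mem measurableSet_Ioi] with s hs
    have hs' : ξ < s := hs
    rw [hb s hs', abs_of_nonpos (sub_nonpos.2 (hmono hs'.le)), neg_neg, sub_eq_add_neg,
      Real.exp_add]
    ring
  have hli := (integrableOn_exp_comp_mul_Iic hy hmono hint ξ).const_mul (a * Real.exp (-y ξ))
  have hri := (integrableOn_exp_neg_comp_mul_Ioi hy hmono hint ξ).const_mul (b * Real.exp (y ξ))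
  rw [← intervalIntegral.integral_Iic_add_Ioi (hli.congr hl) (hri.congr hr),
    ← integral_congr_ae hl, ← integral_congr_ae hr, integral_const_mul, integral_const_mul,
    leftMass, rightMass]

theorem hasDerivAt_exp_mul_masses {y' : ℝ} (hy : Continuous y) (hw : Continuous w)
    (hmono : Monotone y) (hint : Integrable w) (a b : ℝ) {ξ : ℝ} (hξ : HasDerivAt y y' ξ) :
    HasDerivAt
      (fun ξ => a * Real.exp (-y ξ) * leftMass y w ξ + b * Real.exp (y ξ) * rightMass y w ξ)
      (y' * (-a * Real.exp (-y ξ) * leftMass y w ξ + b * Real.exp (y ξ) * rightMass y w ξ)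
        + (a - b) * w ξ) ξ := by
  have hA : HasDerivAt (leftMass y w) (Real.exp (y ξ) * w ξ) ξ :=
    hasDerivAt_integral_Iic ((Real.continuous_exp.comp hy).mul hw)
      (integrableOn_exp_comp_mul_Iic hy hmono hint) ξ
  have hB : HasDerivAt (rightMass y w) (-(Real.exp (-y ξ) * w ξ)) ξ :=
    hasDerivAt_integral_Ioi ((Real.continuous_exp.comp hy.neg).mul hw)
      (integrableOn_exp_neg_comp_mul_Ioi hy hmono hint) ξ
  refine (((hξ.fun_neg.exp.const_mul a).mul hA).add
    ((hξ.exp.const_mul b).mul hB)).congr_deriv ?_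
  have he : Real.exp (-y ξ) * Real.exp (y ξ) = 1 := by rw [← Real.exp_add]; simp
  linear_combination (a - b) * w ξ * he

end Green

section Lagrangian

variable {y U H : ℝ → ℝ}

theorem lagP_eq_masses (hy : Continuous y) (hmono : Monotone y) (hint : Integrable (lagW y U H)) :
    lagP y U H = fun ξ => 1 / 4 * Real.exp (-y ξ) * leftMass y (lagW y U H) ξ
      + 1 / 4 * Real.exp (y ξ) * rightMass y (lagW y U H) ξ := by
  funext ξ
  have h := integral_exp_neg_abs_eq hy hmono hint ξ (σ := fun _ => 1) (fun _ _ => rfl)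
    (fun _ _ => rfl)
  simp only [one_mul] at h
  rw [lagP, h]
  ring

theorem lagQ_eq_masses (hy : Continuous y) (hmono : Monotone y) (hint : Integrable (lagW y U H)) :
    lagQ y U H = fun ξ => -(1 / 4) * Real.exp (-y ξ) * leftMass y (lagW y U H) ξ
      + 1 / 4 * Real.exp (y ξ) * rightMass y (lagW y U H) ξ := by
  funext ξ
  have h := integral_exp_neg_abs_eq hy hmono hint ξ (σ := fun s => Real.sign (ξ - s))
    (fun s hs => Real.sign_of_pos (sub_pos.2 hs)) (fun s hs => Real.sign_of_neg (sub_neg.2 hs))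
  rw [lagQ, h]
  ring

theorem hasDerivAt_lagP (hy : Differentiable ℝ y) (hw : Continuous (lagW y U H))
    (hmono : Monotone y) (hint : Integrable (lagW y U H)) (ξ : ℝ) :
    HasDerivAt (lagP y U H) (deriv y ξ * lagQ y U H ξ) ξ := by
  rw [lagP_eq_masses hy.continuous hmono hint, lagQ_eq_masses hy.continuous hmono hint]
  exact (hasDerivAt_exp_mul_masses hy.continuous hw hmono hint (1 / 4) (1 / 4)
    (hy ξ).hasDerivAt).congr_deriv (by ring)

theorem hasDerivAt_lagQ (hy : Differentiable ℝ y) (hw : Continuous (lagW y U H))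
    (hmono : Monotone y) (hint : Integrable (lagW y U H)) (ξ : ℝ) :
    HasDerivAt (lagQ y U H) (deriv y ξ * lagP y U H ξ - 1 / 2 * lagW y U H ξ) ξ := by
  rw [lagP_eq_masses hy.continuous hmono hint, lagQ_eq_masses hy.continuous hmono hint]
  exact (hasDerivAt_exp_mul_masses hy.continuous hw hmono hint (-(1 / 4)) (1 / 4)
    (hy ξ).hasDerivAt).congr_deriv (by ring)

end Lagrangian

/-- `P_ξ = y_ξ Q`, `P` satisfies the second-order differential
equation, and `P` is constant wherever `y` is constant. -/
theorem stmt_17 (y U H : ℝ → ℝ)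
    (hy : ContDiff ℝ (⊤ : ℕ∞) y) (hU : ContDiff ℝ (⊤ : ℕ∞) U) (hH : ContDiff ℝ (⊤ : ℕ∞) H)
    (hmono : Monotone y) (hint : Integrable (lagW y U H) volume) :
    (∀ ξ : ℝ, deriv (lagP y U H) ξ = deriv y ξ * lagQ y U H ξ) ∧
    (∀ ξ : ℝ,
      deriv y ξ * deriv (deriv (lagP y U H)) ξ
          - deriv (deriv y) ξ * deriv (lagP y U H) ξ
          - (deriv y ξ)^3 * lagP y U H ξ
        = -(1/2) * (deriv y ξ)^2 * lagW y U H ξ) ∧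
    (∀ ξ₁ ξ₂ : ℝ, y ξ₁ = y ξ₂ → lagP y U H ξ₁ = lagP y U H ξ₂) := by
  have hyd : Differentiable ℝ y := hy.differentiable (by simp)
  have hy' : ContDiff ℝ (⊤ : ℕ∞) (deriv y) := (contDiff_infty_iff_deriv.1 hy).2
  have hw : Continuous (lagW y U H) :=
    ((continuous_const.mul (hU.continuous.pow 2)).mul hy'.continuous).add
      (contDiff_infty_iff_deriv.1 hH).2.continuous
  have hP : deriv (lagP y U H) = fun ξ => deriv y ξ * lagQ y U H ξ :=
    funext fun ξ => (hasDerivAt_lagP hyd hw hmono hint ξ).deriv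
  refine ⟨fun ξ => congrFun hP ξ, fun ξ => ?_, fun ξ₁ ξ₂ h => by simp only [lagP, h]⟩
  have hP' : deriv (fun ξ => deriv y ξ * lagQ y U H ξ) ξ = _ :=
    ((hy'.differentiable (by simp) ξ).hasDerivAt.fun_mul
      (hasDerivAt_lagQ hyd hw hmono hint ξ)).deriv
  rw [hP, hP']
  ring
end
end

section
/- Let y, U, H, P : ℝ × ℝ → ℝ be sufficiently smooth functions satisfying y_{ξt} = U_ξ, U_{ξt} = ½ H_ξ + (U² − P) y_ξ and H_{ξt} = 2(U² − P) U_ξ. Then the quantity y_ξ H_ξ − U_ξ² is independent of t, i.e., ∂_t (y_ξ(ξ,t) H_ξ(ξ,t) − U_ξ(ξ,t)²) = 0 for all (ξ,t). In particular, if r is defined by r² = y_ξ H_ξ − U_ξ², then 2 r r_t = 0, so the Lagrangian variable r does not evolve in time. -/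
open MeasureTheory Filter Set Topology

noncomputable section
/-- The first partial derivative is a directional derivative of the uncurried function. -/
theorem pd1_eq_fderiv_uncurry {f : ℝ → ℝ → ℝ} (hf : Differentiable ℝ (Function.uncurry f))
    (a b : ℝ) : pd1 f a b = fderiv ℝ (Function.uncurry f) (a, b) (1, 0) := by
  have hline : HasDerivAt (fun a' : ℝ => (a', b)) ((1 : ℝ), (0 : ℝ)) a :=
    (hasDerivAt_id a).prodMk (hasDerivAt_const a b)
  exact ((hf (a, b)).hasFDerivAt.comp_hasDerivAt a hline).deriv

/-- For a `C²` function, the first partial derivative is differentiable in the second variable. -/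
theorem hasDerivAt_pd1_right {f : ℝ → ℝ → ℝ} (hf : ContDiff ℝ 2 (Function.uncurry f))
    (a b : ℝ) : HasDerivAt (fun b' => pd1 f a b') (pd2 (pd1 f) a b) b := by
  refine DifferentiableAt.hasDerivAt ?_
  simp_rw [pd1_eq_fderiv_uncurry (hf.differentiable (by norm_num))]
  have hfd : Differentiable ℝ (fderiv ℝ (Function.uncurry f)) :=
    (hf.fderiv_right (m := 1) (by norm_num)).differentiable (by norm_num)
  fun_prop

/-- the quantity `y_ξ H_ξ − U_ξ²` is independent of time; in
particular `2 r r_t = 0` for any `r` with `r² = y_ξ H_ξ − U_ξ²`. -/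
theorem stmt_19 (y U H P : ℝ → ℝ → ℝ)
    (hy : ContDiff ℝ (⊤ : ℕ∞) (Function.uncurry y)) (hU : ContDiff ℝ (⊤ : ℕ∞) (Function.uncurry U))
    (hH : ContDiff ℝ (⊤ : ℕ∞) (Function.uncurry H)) (hP : ContDiff ℝ (⊤ : ℕ∞) (Function.uncurry P))
    (e1 : ∀ ξ t : ℝ, pd2 (pd1 y) ξ t = pd1 U ξ t)
    (e2 : ∀ ξ t : ℝ, pd2 (pd1 U) ξ t = (1/2) * pd1 H ξ t + (U ξ t ^ 2 - P ξ t) * pd1 y ξ t)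
    (e3 : ∀ ξ t : ℝ, pd2 (pd1 H) ξ t = 2 * (U ξ t ^ 2 - P ξ t) * pd1 U ξ t) :
    (∀ ξ t : ℝ,
      pd2 (fun a b => pd1 y a b * pd1 H a b - pd1 U a b ^ 2) ξ t = 0) ∧
    ∀ r : ℝ → ℝ → ℝ, (∀ ξ : ℝ, Differentiable ℝ (fun t => r ξ t)) →
      (∀ ξ t : ℝ, r ξ t ^ 2 = pd1 y ξ t * pd1 H ξ t - pd1 U ξ t ^ 2) →
      ∀ ξ t : ℝ, 2 * r ξ t * pd2 r ξ t = 0 := by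
  have two_le : (2 : WithTop ℕ∞) ≤ ((⊤ : ℕ∞) : WithTop ℕ∞) := 
    WithTop.coe_le_coe.2 (le_top : (2 : ℕ∞) ≤ ⊤)
  have conserved (ξ t : ℝ) :
      HasDerivAt (fun b => pd1 y ξ b * pd1 H ξ b - pd1 U ξ b ^ 2) 0 t := by
    have dy := hasDerivAt_pd1_right (hy.of_le two_le) ξ t
    have dU := hasDerivAt_pd1_right (hU.of_le two_le) ξ t
    have dH := hasDerivAt_pd1_right (hH.of_le two_le) ξ t
    refine ((dy.fun_mul dH).fun_sub (dU.fun_pow 2)).congr_deriv ?_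
    rw [e1, e2, e3]
    push_cast
    ring
  refine ⟨fun ξ t => (conserved ξ t).deriv, fun r hr hr2 ξ t => ?_⟩
  have dr : HasDerivAt (fun b => r ξ b ^ 2) (2 * r ξ t * pd2 r ξ t) t := by
    simpa [pd2] using (hr ξ t).hasDerivAt.fun_pow 2
  simp_rw [hr2] at dr
  exact dr.unique (conserved ξ t)
end
end
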